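/- Let N̄(m,n) denote the number of overpartitions of n with D-rank m. Then for all integers m ≥ 0 and n ≥ 1 with n ≠ m+2 and (m,n) ≠ (0,4), one has N̄(m,n) ≥ N̄(m,n−1). -/

import Mathlib

/-- An overpartition of `n` is a partition of `n` together with a set of part sizes
whose first occurrence is overlined; we model it as a pair `(λ, S)` with
`λ : Nat.Partition n` and `S` a subset of the set of part sizes of `λ`.
`overN m n` is the number of overpartitions of `n` whose D-rank
(largest part minus number of parts) equals `m`. -/
noncomputable def overN (m : ℤ) (n : ℕ) : ℕ :=
  Set.ncard {p : n.Partition × Finset ℕ |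
    p.2 ⊆ p.1.parts.toFinset ∧ (p.1.parts.sup : ℤ) - Multiset.card p.1.parts = m}

namespace OverN
open PowerSeries LaurentPolynomial

abbrev R := LaurentPolynomial ℤ
abbrev S := PowerSeries R

/-- Laurent polynomials with nonnegative coefficients. -/
noncomputable def LNN : Subsemiring R :=
  (AddMonoidAlgebra.mapRingHom ℤ (Nat.castRingHom ℤ)).rangeS

lemma coeff_nonneg_of_LNN {f : R} (h : f ∈ LNN) (m : ℤ) : 0 ≤ f.coeff m := by
  obtain ⟨g, rfl⟩ := h
  simp

lemma T_mem (m : ℤ) : (T m : R) ∈ LNN := by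
  refine ⟨T m, ?_⟩
  rw [T, AddMonoidAlgebra.mapRingHom_single, map_one]
  rfl

/-- Power series with nonnegative coefficients. -/
noncomputable def NN : Subsemiring S where
  carrier := {f | ∀ n, coeff n f ∈ LNN}
  mul_mem' := by
    intro a b ha hb n
    rw [coeff_mul]
    exact sum_mem fun i _ => mul_mem (ha _) (hb _)
  one_mem' := by
    intro n
    rw [coeff_one]
    split_ifs
    · exact one_mem _
    · exact zero_mem _
  add_mem' := by
    intro a b ha hb n
    rw [map_add]
    exact add_mem (ha _) (hb _)
  zero_mem' := by
    intro n
    simp [zero_mem]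

lemma mem_NN {f : S} : f ∈ NN ↔ ∀ n, coeff n f ∈ LNN := Iff.rfl

noncomputable def Z : S := PowerSeries.C (T 1)
noncomputable def W : S := PowerSeries.C (T (-1))
noncomputable def q : S := PowerSeries.X

lemma ZW : Z * W = 1 := by
  rw [Z, W, ← map_mul, ← T_add]; simp

lemma C_T_NN (m : ℤ) : (PowerSeries.C (T m) : S) ∈ NN := by
  intro n
  rw [coeff_C]
  split_ifs
  · exact T_mem _
  · exact zero_mem _

lemma Z_NN : Z ∈ NN := C_T_NN _
lemma W_NN : W ∈ NN := C_T_NN _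
lemma q_NN : q ∈ NN := by
  intro n
  rw [q, coeff_X]
  split_ifs
  · exact one_mem _
  · exact zero_mem _

/-- `1/(1 - q^j/z)` -/
noncomputable def g (j : ℕ) : S := PowerSeries.mk fun n => if j ∣ n then T (-((n / j : ℕ) : ℤ)) else 0

lemma g_NN (j : ℕ) : g j ∈ NN := by
  intro n
  rw [g, coeff_mk]
  split_ifs
  · exact T_mem _
  · exact zero_mem _

lemma g_mul (j : ℕ) (hj : 0 < j) : (1 - W * q ^ j) * g j = 1 := by
  ext1 n
  rw [sub_mul, one_mul, map_sub, mul_assoc, W, q, coeff_C_mul, coeff_X_pow_mul', coeff_one]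
  simp only [g, coeff_mk]
  rcases Nat.lt_or_ge n j with h | h
  · rcases Nat.eq_zero_or_pos n with rfl | h0
    · simp [hj.ne']
    · have : ¬ j ∣ n := Nat.not_dvd_of_pos_of_lt h0 h
      rw [if_neg this, if_neg (by omega), if_neg h0.ne', mul_zero, sub_zero]
  · obtain ⟨k, rfl⟩ := Nat.exists_eq_add_of_le h
    have h3 : (j + k) / j = k / j + 1 := by
      rw [Nat.add_div_left _ hj]
    have h4 : j + k ≠ 0 := by omega
    simp only [Nat.dvd_add_right (dvd_refl j), h3, h4, h, if_true, if_false, Nat.add_sub_cancel_left]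
    split_ifs with hd
    · rw [← T_add]
      rw [show (-((k / j + 1 : ℕ):ℤ) : ℤ) = -1 + -((k / j:ℕ):ℤ) by push_cast; ring, sub_self]
    · simp

/-- `1/(1 - z q)` -/
noncomputable def h : S := PowerSeries.mk fun n => T (n : ℤ)

lemma h_mul : (1 - Z * q) * h = 1 := by
  ext1 n
  rw [sub_mul, one_mul, map_sub, mul_assoc, Z, q, coeff_C_mul, coeff_one]
  rcases n with _ | n
  · simp [h]
  · rw [coeff_succ_X_mul, h, coeff_mk, coeff_mk, ← T_add]
    push_cast
    rw [add_comm (1:ℤ)]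
    simp

noncomputable def D (k n : ℕ) : S := ∏ j ∈ Finset.range n, (1 + W * q ^ (j + 1)) * g (j + 1 + k)

lemma D_succ (k n : ℕ) : D k (n+1) = D k n * ((1 + W * q ^ (n + 1)) * g (n + 1 + k)) := by
  rw [D, Finset.prod_range_succ, D]

lemma D_shift (k n : ℕ) : D k n * g (n + 1 + k) = g (k + 1) * D (k + 1) n := by
  induction n with
  | zero => simp [D, add_comm]
  | succ n ih =>
    rw [D_succ, D_succ]
    rw [show n + 1 + 1 + k = n + 1 + (k + 1) by ring]
    linear_combination ((1 + W * q ^ (n + 1)) * g (n + 1 + (k + 1))) * ih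

lemma D_diff (k n : ℕ) : D k (n+1) - D k n = W * q ^ (n + 1) * (1 + q ^ k) * g (k + 1) * D (k + 1) n := by
  have := g_mul (n + 1 + k) (by omega)
  rw [D_succ, mul_assoc _ (g (k+1)), ← D_shift]
  linear_combination (D k n) * this

/-- partial sum of `G_k` -/
noncomputable def G (k N : ℕ) : S := ∑ n ∈ Finset.range N, (Z * q ^ k) ^ n * D k n

lemma G_rec (k N : ℕ) : (1 - Z * q ^ k) * G k (N + 1) =
    1 - (Z * q ^ k) ^ (N + 1) * D k N + (1 + q ^ k) * q ^ (k + 1) * g (k + 1) * G (k + 1) N := by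
  induction N with
  | zero => simp [G, D]
  | succ N ih =>
    have h1 : G k (N + 1 + 1) = G k (N + 1) + (Z * q ^ k) ^ (N + 1) * D k (N + 1) := by
      rw [G, Finset.sum_range_succ, G]
    have h2 : G (k + 1) (N + 1) = G (k + 1) N + (Z * q ^ (k + 1)) ^ N * D (k + 1) N := by
      rw [G, Finset.sum_range_succ, G]
    rw [h1, h2, mul_add, ih]
    have h3 := D_diff k N
    linear_combination (Z * q ^ k) ^ (N + 1) * h3 + (Z * q ^ k) ^ N * q ^ k * q ^ (N+1) * (1 + q ^ k) * g (k + 1) * D (k + 1) N * ZW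

/-- Generating function (truncated) -/
noncomputable def P (N : ℕ) : S := ∑ a ∈ Finset.range N, Z ^ (a + 1) * (D 0 (a + 1) - D 0 a)

lemma P_eq (N : ℕ) : P N = 2 * q * g 1 * G 1 N := by
  rw [P, G, Finset.mul_sum]
  refine Finset.sum_congr rfl fun a _ => ?_
  rw [D_diff]
  linear_combination (2 * q * q ^ a * Z ^ a * g 1 * D 1 a) * ZW

/-- `∑ z^m q^|m|` -/
noncomputable def V : S := PowerSeries.mk fun n => if n = 0 then 1 else T (n:ℤ) + T (-(n:ℤ))

lemma V_NN : V ∈ NN := by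
  intro n
  rw [V, coeff_mk]
  split_ifs
  · exact one_mem _
  · exact add_mem (T_mem _) (T_mem _)

lemma V_eq' : V = g 1 + h - 1 := by
  ext1 n
  rw [map_sub, map_add, V, g, h, coeff_one]
  simp only [coeff_mk]
  split_ifs with h <;> simp_all [add_comm]

lemma V_eq : V = (1 - q ^ 2) * g 1 * h := by
  have h1 := g_mul 1 one_pos
  have h2 := h_mul
  rw [V_eq']
  linear_combination (- Z*q*h) * h1 + (-g 1 + 1) * h2 - q^2 * g 1 * h * ZW

/-- `(1-q)/((1-zq)(1-q/z))` -/
noncomputable def A : S := (1 - q) * g 1 * h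

lemma A_mul : (1 + q) * A = V := by rw [V_eq, A]; ring

lemma A_coeff (n : ℕ) (m : ℤ) : (coeff n A).coeff m = if m.natAbs ≤ n then (-1) ^ (n - m.natAbs) else 0 := by
  have key : ∀ n, coeff (n + 1) A + coeff n A = coeff (n + 1) V := by
    intro n
    rw [← A_mul, add_mul, one_mul, map_add, q, coeff_succ_X_mul]
  have key0 : coeff 0 A = 1 := by
    have : coeff 0 ((1 + q) * A) = coeff 0 V := by rw [A_mul]
    rw [add_mul, one_mul, map_add, q, coeff_zero_X_mul, add_zero] at this
    rw [this, V, coeff_mk, if_pos rfl]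
  induction n with
  | zero =>
    rw [key0, ← T_zero, T_apply]
    by_cases hm : m = 0 <;> simp [hm, eq_comm]
  | succ n ih =>
    have h1 : (coeff (n + 1) A).coeff m = (coeff (n + 1) V).coeff m - (coeff n A).coeff m := by
      rw [← key]; simp
    rw [h1, ih, V, coeff_mk, if_neg (by omega)]
    have h2 : (T ((n + 1 : ℕ) : ℤ) + T (-((n + 1 : ℕ) : ℤ)) : R).coeff m = 
       (if ((n + 1 : ℕ) : ℤ) = m then 1 else 0) + (if -((n + 1 : ℕ) : ℤ) = m then 1 else 0) := by
      rw [← T_apply, ← T_apply]; rfl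
    rw [h2]
    rcases lt_trichotomy m.natAbs (n + 1) with h | h | h
    · rw [if_neg (by omega), if_neg (by omega), if_pos (by omega), if_pos (by omega),
        Nat.succ_sub (by omega), pow_succ]
      ring
    · rw [if_neg (show ¬ m.natAbs ≤ n by omega), if_pos (show m.natAbs ≤ n + 1 by omega), h]
      rcases Int.natAbs_eq m with h' | h'
      · rw [if_pos (by omega), if_neg (by omega)]; simp
      · rw [if_neg (by omega), if_pos (by omega)]; simp
    · rw [if_neg (by omega), if_neg (by omega), if_neg (by omega), if_neg (by omega)]; simp

/-- The key identity. -/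
lemma P_key (N : ℕ) : (1 - q) * P (N + 1) = 2 * q * A + 2 * q ^ 3 * (V * g 2 * G 2 N)
    - q ^ (N + 2) * (2 * A * Z ^ (N + 1) * D 1 N) := by
  have h1 := G_rec 1 N
  have h2 := h_mul
  rw [P_eq, V_eq, A]
  rw [show 1 + 1 = 2 from rfl] at h1
  linear_combination (2 * q * (1 - q) * g 1 * h) * h1 - (2 * q * (1 - q) * g 1 * G 1 (N+1)) * h2 

lemma D_NN (k n : ℕ) : D k n ∈ NN := 
  prod_mem fun _ _ => mul_mem (add_mem (one_mem _) (mul_mem W_NN (pow_mem q_NN _))) (g_NN _)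

lemma G_NN (k n : ℕ) : G k n ∈ NN := 
  sum_mem fun _ _ => mul_mem (pow_mem (mul_mem Z_NN (pow_mem q_NN _)) _) (D_NN _ _)

noncomputable def mono (m : ℤ) (n : ℕ) : S := PowerSeries.C (T m) * q ^ n

lemma mono_mul (a b : ℤ) (c d : ℕ) : mono a c * mono b d = mono (a + b) (c + d) := by
  simp only [mono, T_add, map_mul, pow_add]; ring

lemma mono_NN (m : ℤ) (n : ℕ) : mono m n ∈ NN := mul_mem (C_T_NN _) (pow_mem q_NN _)

lemma coeff_mono (m m' : ℤ) (n n' : ℕ) : (coeff n' (mono m n)).coeff m' = if n' = n ∧ m = m' then 1 else 0 := by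
  rw [mono, coeff_C_mul, q, coeff_X_pow]
  by_cases h : n' = n <;> simp [h]

/-- `f` dominates the monomial `z^m q^n`. -/
def Ge (f : S) (m : ℤ) (n : ℕ) : Prop := f - mono m n ∈ NN

lemma Ge.mul {f f' : S} {a b : ℤ} {c d : ℕ} (h1 : Ge f a c) (h2 : Ge f' b d) (hf' : f' ∈ NN) : Ge (f * f') (a + b) (c + d) := by
  have : f * f' - mono (a + b) (c + d) = (f - mono a c) * f' + mono a c * (f' - mono b d) := by
    rw [← mono_mul]; ring
  rw [Ge, this]
  exact add_mem (mul_mem h1 hf') (mul_mem (mono_NN _ _) h2)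

lemma Ge.add {f f' : S} {a : ℤ} {c : ℕ} (h1 : Ge f a c) (hf' : f' ∈ NN) : Ge (f + f') a c := by
  rw [Ge, add_sub_right_comm]
  exact add_mem h1 hf'

lemma Ge_mono (m : ℤ) (n : ℕ) : Ge (mono m n) m n := by rw [Ge, sub_self]; exact zero_mem _

lemma Ge_of_coeff {f : S} {m : ℤ} {n : ℕ} (hf : f ∈ NN) (h : coeff n f - T m ∈ LNN) : Ge f m n := by
  intro k
  rw [map_sub, mono, coeff_C_mul, q, coeff_X_pow]
  split_ifs with hk
  · subst hk; simpa using h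
  · simpa using hf k

lemma Ge.coeff {f : S} {m : ℤ} {n : ℕ} (h : Ge f m n) : 1 ≤ (coeff n f).coeff m := by
  have h1 := coeff_nonneg_of_LNN (h n) m
  have h2 : (PowerSeries.coeff n (f - mono m n)).coeff m = (PowerSeries.coeff n f).coeff m - (PowerSeries.coeff n (mono m n)).coeff m := by
    rw [map_sub]; rfl
  rw [h2, coeff_mono] at h1
  simp at h1
  exact h1

lemma Ge_V (m : ℤ) (n : ℕ) (hm : m.natAbs = n) : Ge V m n := by
  apply Ge_of_coeff V_NN
  rw [V, coeff_mk]
  split_ifs with h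
  · have : m = 0 := by omega
    subst this
    simp [zero_mem]
  · rcases Int.natAbs_eq m with h' | h'
    · rw [hm] at h'; rw [h', add_sub_cancel_left]; exact T_mem _
    · rw [hm] at h'; rw [h', add_sub_cancel_right]; exact T_mem _

lemma Ge_g (j i : ℕ) (hj : 0 < j) : Ge (g j) (-(i:ℤ)) (j * i) := by
  apply Ge_of_coeff (g_NN _)
  rw [g, coeff_mk, if_pos (by simp), Nat.mul_div_cancel_left _ hj, sub_self]
  exact zero_mem _

lemma Ge_one : Ge 1 0 0 := by
  rw [Ge, mono]; simp [zero_mem]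

lemma Ge_fac (j : ℕ) : Ge (1 + W * q ^ j) 0 0 := 
  Ge_one.add (mul_mem W_NN (pow_mem q_NN _))

lemma fac_NN (j : ℕ) : 1 + W * q ^ j ∈ NN := 
  add_mem (one_mem _) (mul_mem W_NN (pow_mem q_NN _))

lemma Ge_D (k n : ℕ) : Ge (D k n) 0 0 := by
  induction n with
  | zero => simpa [D] using Ge_one
  | succ n ih =>
    rw [D_succ]
    have := ih.mul ((Ge_fac (n+1)).mul (Ge_g (n + 1 + k) 0 (by omega)) (g_NN _)) (mul_mem (fac_NN _) (g_NN _))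
    simpa using this

lemma Ge_D' (n : ℕ) : Ge (D 2 (n + 1)) (-1) 3 := by
  induction n with
  | zero => 
    rw [D_succ]
    have := (Ge_D 2 0).mul ((Ge_fac (0+1)).mul (Ge_g (0 + 1 + 2) 1 (by omega)) (g_NN _)) (mul_mem (fac_NN _) (g_NN _))
    simpa using this
  | succ n ih =>
    rw [D_succ]
    have := ih.mul ((Ge_fac (n+1+1)).mul (Ge_g (n + 1+1 + 2) 0 (by omega)) (g_NN _)) (mul_mem (fac_NN _) (g_NN _))
    simpa using this

lemma Zq_pow (n : ℕ) : (Z * q ^ 2) ^ n = mono n (2 * n) := by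
  rw [mono, Z, mul_pow, ← map_pow, T_pow, ← pow_mul, mul_one]

lemma G_split (n N : ℕ) (h : n < N) : ∃ f ∈ NN, G 2 N = mono n (2 * n) * D 2 n + f := by
  refine ⟨∑ x ∈ (Finset.range N).erase n, (Z * q ^ 2) ^ x * D 2 x, ?_, ?_⟩
  · exact sum_mem fun _ _ => mul_mem (pow_mem (mul_mem Z_NN (pow_mem q_NN _)) _) (D_NN _ _)
  · rw [← Zq_pow, G, Finset.add_sum_erase _ (fun x => (Z * q ^ 2) ^ x * D 2 x) (Finset.mem_range.2 h)]

lemma Ge_G (n N : ℕ) (h : n < N) : Ge (G 2 N) n (2 * n) := by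
  obtain ⟨f, hf, e⟩ := G_split n N h
  rw [e]
  have := ((Ge_mono n (2 * n)).mul (Ge_D 2 n) (D_NN _ _)).add hf
  simpa using this

lemma Ge_G' (n N : ℕ) (h : n + 1 < N) : Ge (G 2 N) n (2 * n + 5) := by
  obtain ⟨f, hf, e⟩ := G_split (n + 1) N h
  rw [e]
  have := ((Ge_mono ((n + 1 : ℕ):ℤ) (2 * (n + 1))).mul (Ge_D' n) (D_NN _ _)).add hf
  rw [show ((n + 1 : ℕ):ℤ) + -1 = n by push_cast; ring] at this
  exact this

lemma Q_NN (N : ℕ) : V * g 2 * G 2 N ∈ NN := mul_mem (mul_mem V_NN (g_NN _)) (G_NN _ _)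

/-- positivity of the compensating coefficients -/
lemma Q_pos (m j N : ℕ) (hj : 2 ≤ j) (h : ¬ (m = 0 ∧ j = 2)) (hN : j < N) :
    1 ≤ (coeff (m + 2 * j - 3) (V * g 2 * G 2 N)).coeff m := by
  apply Ge.coeff
  rcases Nat.even_or_odd' j with ⟨k, rfl | rfl⟩
  · obtain ⟨i, rfl⟩ : ∃ i, k = i + 1 := ⟨k - 1, by omega⟩
    rcases Nat.eq_zero_or_pos m with rfl | hm
    · obtain ⟨i, rfl⟩ : ∃ i', i = i' + 1 := ⟨i - 1, by omega⟩
      have := ((Ge_V 0 0 rfl).mul (Ge_g 2 i two_pos) (g_NN _)).mul (Ge_G' i N (by omega)) (G_NN _ _)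
      convert this using 1
      · simp
      · omega
    · have := ((Ge_V (m - 1) (m - 1) (by omega)).mul (Ge_g 2 i two_pos) (g_NN _)).mul (Ge_G (i + 1) N (by omega)) (G_NN _ _)
      convert this using 1
      · push_cast; ring
      · omega
  · obtain ⟨i, rfl⟩ : ∃ i, k = i + 1 := ⟨k - 1, by omega⟩
    have := ((Ge_V (m + 1) (m + 1) (by omega)).mul (Ge_g 2 (i + 1) two_pos) (g_NN _)).mul (Ge_G i N (by omega)) (G_NN _ _)
    convert this using 1
    · push_cast; ring
    · omega

/-- coefficient of the full generating function -/
noncomputable def c (N n : ℕ) (m : ℤ) : ℤ := (coeff n (1 + P N)).coeff m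

lemma c_mono (N n m : ℕ) (hN : n < N) (h1 : n + 1 ≠ m + 2) (h2 : ¬ (m = 0 ∧ n + 1 = 4)) :
    c (N + 1) n m ≤ c (N + 1) (n + 1) m := by
  have key : coeff (n + 1) (1 + P (N + 1)) - coeff n (1 + P (N + 1)) = 
      (if n = 0 then -1 else 0) + (2 * coeff n A + 2 * (if 2 ≤ n then coeff (n - 2) (V * g 2 * G 2 N) else 0)) := by
    have e : coeff (n + 1) ((1 - q) * (1 + P (N + 1))) = coeff (n + 1) (1 + P (N + 1)) - coeff n (1 + P (N + 1)) := by
      rw [sub_mul, one_mul, map_sub, q, coeff_succ_X_mul]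
    rw [← e, mul_add, mul_one, P_key, map_add]
    congr 1
    · rw [map_sub, coeff_one, q, coeff_X]; by_cases h : n = 0 <;> simp [h]
    · rw [map_sub, map_add, q, coeff_X_pow_mul', if_neg (by omega), sub_zero]
      congr 1
      · rw [mul_assoc, show (2 : S) = PowerSeries.C 2 from rfl, coeff_C_mul, coeff_succ_X_mul]
      · rw [mul_assoc, show (2 : S) = PowerSeries.C 2 from rfl, coeff_C_mul, coeff_X_pow_mul']
        by_cases hn : 2 ≤ n
        · rw [if_pos hn, if_pos (by omega), show n + 1 - 3 = n - 2 by omega]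
        · rw [if_neg hn, if_neg (by omega)]
  have key2 : c (N + 1) (n + 1) m - c (N + 1) n m = 
      (if n = 0 ∧ m = 0 then -1 else 0) + (2 * (coeff n A).coeff m + 2 * (if 2 ≤ n then (coeff (n - 2) (V * g 2 * G 2 N)).coeff m else 0)) := by
    have := congrArg (fun f : R => f.coeff m) key
    simp only [two_mul, AddMonoidAlgebra.coeff_add, AddMonoidAlgebra.coeff_sub, Finsupp.add_apply, Finsupp.sub_apply] at this
    rw [c, c, this, two_mul, two_mul]
    have e1 : (1 : R).coeff m = if m = 0 then 1 else 0 := by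
      rw [← T_zero, T_apply]; simp [eq_comm]
    congr 1
    · by_cases h : n = 0 <;> by_cases h' : m = 0 <;> simp [h, h', e1]
    · by_cases h : 2 ≤ n <;> simp [h]
  rw [← sub_nonneg, key2, A_coeff]
  have hQ : 0 ≤ (if 2 ≤ n then (coeff (n - 2) (V * g 2 * G 2 N)).coeff m else 0) := by
    split_ifs
    · exact coeff_nonneg_of_LNN (Q_NN N _) _
    · exact le_rfl
  by_cases hn : n = 0
  · subst hn
    rcases Nat.eq_zero_or_pos m with rfl | hm
    · simp
    · simp [hm.ne']
  rw [if_neg (by omega)]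
  simp only [Int.natAbs_natCast]
  by_cases hmn : m ≤ n
  · rw [if_pos hmn]
    obtain ⟨d, rfl⟩ := Nat.exists_eq_add_of_le hmn
    rw [Nat.add_sub_cancel_left]
    rcases Nat.even_or_odd d with hd | hd
    · rw [hd.neg_one_pow]; omega
    · rw [hd.neg_one_pow]
      obtain ⟨i, rfl⟩ := hd
      rw [if_pos (by omega)]
      have := Q_pos m (i + 1) N (by omega) (by omega) (by omega)
      rw [show m + 2 * (i + 1) - 3 = m + (2 * i + 1) - 2 by omega] at this
      omega
  · rw [if_neg hmn]; omega

noncomputable def ff (a i k : ℕ) : R := if i ≤ a then 2 * T (-(k : ℤ)) else 0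

section
open scoped PowerSeries.WithPiTopology

lemma genFun_ff (a : ℕ) : Nat.Partition.genFun (ff a) = D 0 a := by
  let _ : TopologicalSpace R := ⊥
  have : DiscreteTopology R := ⟨rfl⟩
  have key : ∀ i, (1 : S) + ∑' j, ff a (i + 1) (j + 1) • (PowerSeries.X : S) ^ ((i + 1) * (j + 1)) =
      if i < a then (1 + W * q ^ (i + 1)) * g (i + 1) else 1 := by
    intro i
    split_ifs with hi
    · have hx : PowerSeries.constantCoeff (W * q ^ (i + 1)) = 0 := by
        simp [q]
      have e : ∀ j, ff a (i + 1) (j + 1) • (PowerSeries.X : S) ^ ((i + 1) * (j + 1)) =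
          2 * (W * q ^ (i + 1)) * (W * q ^ (i + 1)) ^ j := by
        intro j
        have e2 : (T (-((j + 1 : ℕ) : ℤ)) : R) = T (-1) ^ (j + 1) := by
          rw [T_pow]; congr 1; ring
        rw [ff, if_pos (by omega), PowerSeries.smul_eq_C_mul, map_mul, e2, map_pow, pow_mul, mul_assoc (2 : S),
          ← pow_succ', mul_pow, ← mul_assoc (2 : S)]
        rfl
      have hs := WithPiTopology.summable_pow_of_constantCoeff_eq_zero hx
      have h1 := WithPiTopology.one_sub_mul_tsum_pow_of_constantCoeff_eq_zero hx
      have h2 := g_mul (i + 1) (by omega)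
      simp_rw [e]
      rw [hs.tsum_mul_left]
      have h3 : ∑' j, (W * q ^ (i + 1)) ^ j = g (i + 1) := by
        linear_combination (g (i + 1)) * h1 - (∑' j, (W * q ^ (i + 1)) ^ j) * h2
      rw [h3]
      linear_combination -h2
    · have : ∀ j, ff a (i + 1) (j + 1) = 0 := fun j => by rw [ff, if_neg (by omega)]
      simp [this]
  have h := Nat.Partition.hasProd_genFun (ff a)
  simp_rw [key] at h
  have h' := hasProd_prod_of_ne_finset_one (L := SummationFilter.unconditional ℕ) (f := fun i => if i < a then (1 + W * q ^ (i + 1)) * g (i + 1) else 1)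
    (s := Finset.range a) (by intro b hb; rw [if_neg (by simpa using hb)])
  rw [h.unique h', D]
  refine Finset.prod_congr rfl fun i hi => ?_
  rw [if_pos (by simpa using hi)]
end

/-- weight -/
noncomputable def wt {n : ℕ} (p : n.Partition) : R :=
  2 ^ p.parts.toFinset.card * T (-(Multiset.card p.parts : ℤ))

lemma prod_ff (a n : ℕ) (p : n.Partition) :
    p.parts.toFinsupp.prod (ff a) = if p.parts.sup ≤ a then wt p else 0 := by
  rw [Finsupp.prod, Multiset.toFinsupp_support]
  simp only [Multiset.toFinsupp_apply]
  split_ifs with h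
  · rw [Multiset.sup_le] at h
    have : ∀ i ∈ p.parts.toFinset, ff a i (p.parts.count i) = 2 * T (-(p.parts.count i : ℤ)) := by
      intro i hi
      rw [ff, if_pos (h i (by simpa using hi))]
    rw [Finset.prod_congr rfl this, Finset.prod_mul_distrib, Finset.prod_const, wt]
    congr 1
    have : ∀ s : Finset ℕ, ∏ i ∈ s, (T (-(p.parts.count i : ℤ)) : R) = T (-((∑ i ∈ s, p.parts.count i : ℕ) : ℤ)) := by
      intro s
      induction s using Finset.induction_on with
      | empty => simp
      | insert x s hx ih => rw [Finset.prod_insert hx, Finset.sum_insert hx, ih, ← T_add]; congr 1; push_cast; ring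
    rw [this, Multiset.toFinset_sum_count_eq]
  · rw [Multiset.sup_le] at h
    push Not at h
    obtain ⟨b, hb, hab⟩ := h
    exact Finset.prod_eq_zero (i := b) (by simpa using hb) (by rw [ff, if_neg (by omega)])

lemma coeff_D (a n : ℕ) : coeff n (D 0 a) = ∑ p : n.Partition, if p.parts.sup ≤ a then wt p else 0 := by
  rw [← genFun_ff, Nat.Partition.coeff_genFun]
  exact Finset.sum_congr rfl fun p _ => prod_ff a n p

lemma sup_le_n {n : ℕ} (p : n.Partition) : p.parts.sup ≤ n := by
  rw [Multiset.sup_le]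
  intro b hb
  conv_rhs => rw [← p.parts_sum]
  exact Multiset.le_sum_of_mem hb

lemma sup_pos {n : ℕ} (hn : 0 < n) (p : n.Partition) : 0 < p.parts.sup := by
  by_contra h
  have h0 : p.parts.sup ≤ 0 := by omega
  rw [Multiset.sup_le] at h0
  have : p.parts.sum = 0 := by
    rw [Multiset.sum_eq_zero_iff]
    intro x hx
    exact Nat.le_zero.1 (h0 x hx)
  rw [p.parts_sum] at this
  omega

lemma coeff_P (N n : ℕ) (hn : n ≤ N) :
    coeff n (1 + P N) = ∑ p : n.Partition, T (p.parts.sup : ℤ) * wt p := by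
  have e : coeff n (P N) = ∑ p : n.Partition, if 0 < p.parts.sup then T (p.parts.sup : ℤ) * wt p else 0 := by
    rw [P, map_sum]
    have : ∀ a, coeff n (Z ^ (a + 1) * (D 0 (a + 1) - D 0 a)) = 
        ∑ p : n.Partition, if p.parts.sup = a + 1 then T (p.parts.sup : ℤ) * wt p else 0 := by
      intro a
      rw [Z, ← map_pow, coeff_C_mul, map_sub, coeff_D, coeff_D, ← Finset.sum_sub_distrib, Finset.mul_sum]
      refine Finset.sum_congr rfl fun p _ => ?_
      rcases lt_trichotomy p.parts.sup (a + 1) with h | h | h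
      · rw [if_pos (by omega), if_pos (by omega), if_neg (by omega)]; simp
      · rw [if_pos (by omega), if_neg (by omega), if_pos (by omega), h, T_pow, sub_zero, mul_one]
      · rw [if_neg (by omega), if_neg (by omega), if_neg (by omega)]; simp
    simp_rw [this]
    rw [Finset.sum_comm]
    refine Finset.sum_congr rfl fun p _ => ?_
    have hp := sup_le_n p
    split_ifs with h
    · rw [Finset.sum_eq_single (p.parts.sup - 1)]
      · rw [if_pos (by omega)]
      · intro b _ hb
        rw [if_neg (by omega)]
      · intro hb
        exact absurd (Finset.mem_range.2 (by omega)) hb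
    · exact Finset.sum_eq_zero fun b _ => by rw [if_neg (by omega)]
  rw [map_add, e, coeff_one]
  rcases Nat.eq_zero_or_pos n with rfl | h
  · simp [wt]
  · rw [if_neg h.ne', zero_add]
    refine Finset.sum_congr rfl fun p _ => ?_
    rw [if_pos (sup_pos h p)]

lemma overN_eq (m : ℤ) (n : ℕ) : overN m n = ∑ p : n.Partition,
    if (p.parts.sup : ℤ) - Multiset.card p.parts = m then 2 ^ p.parts.toFinset.card else 0 := by
  classical
  rw [overN]
  have : {p : n.Partition × Finset ℕ |
    p.2 ⊆ p.1.parts.toFinset ∧ (p.1.parts.sup : ℤ) - Multiset.card p.1.parts = m} =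
    (((Finset.univ.filter fun p : n.Partition => (p.parts.sup : ℤ) - Multiset.card p.parts = m).biUnion
      fun p => ({p} : Finset n.Partition) ×ˢ p.parts.toFinset.powerset : Finset (n.Partition × Finset ℕ)) : Set _) := by
    ext ⟨p, s⟩
    simp [and_comm]
  rw [this, Set.ncard_coe_finset, Finset.card_biUnion, Finset.sum_filter]
  · simp
  · intro x _ y _ hxy
    rw [Function.onFun, Finset.disjoint_left]
    rintro ⟨p, s⟩ h1 h2
    rw [Finset.mem_product, Finset.mem_singleton] at h1 h2
    exact hxy (h1.1.symm.trans h2.1)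

lemma c_eq (N n : ℕ) (hn : n ≤ N) (m : ℤ) : c N n m = overN m n := by
  rw [c, coeff_P N n hn, overN_eq]
  have hs : ∀ (s : Finset n.Partition) (F : n.Partition → R), (∑ p ∈ s, F p).coeff m = ∑ p ∈ s, (F p).coeff m := by
    intro s F
    classical
    induction s using Finset.induction_on with
    | empty => simp
    | insert x s hx ih => rw [Finset.sum_insert hx, Finset.sum_insert hx, ← ih]; rfl
  rw [hs]
  push_cast
  refine Finset.sum_congr rfl fun p _ => ?_
  have : T (p.parts.sup : ℤ) * wt p = ((2 : ℤ) ^ p.parts.toFinset.card) • (T ((p.parts.sup : ℤ) - Multiset.card p.parts) : R) := by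
    rw [wt, sub_eq_add_neg, T_add, LaurentPolynomial.smul_eq_C_mul, map_pow, map_ofNat]
    ring
  rw [this, AddMonoidAlgebra.coeff_smul, Finsupp.smul_apply, T_apply]
  simp

end OverN

theorem overN_monotone (m : ℤ) (hm : 0 ≤ m) (n : ℕ) (hn : 1 ≤ n)
    (h1 : (n : ℤ) ≠ m + 2) (h2 : ¬(m = 0 ∧ n = 4)) :
    overN m (n - 1) ≤ overN m n := by
  obtain ⟨k, rfl⟩ := Int.eq_ofNat_of_zero_le hm
  obtain ⟨j, rfl⟩ : ∃ j, n = j + 1 := ⟨n - 1, by omega⟩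
  have := OverN.c_mono (j + 1) j k (by omega) (by omega) (by omega)
  rw [OverN.c_eq _ _ (by omega), OverN.c_eq _ _ (by omega)] at this
  exact_mod_cast this
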